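/- arXiv:1512.08149 — 3 statements merged into one kernel-verified Lean document; each statement's English description precedes it below -/
import Mathlib

section
/- There exist two non-isomorphic trees T and T' on the same number n of vertices such that W(T) = W(T') and R(T) ≠ R(T'). Consequently, for every nonzero real σ, d_W(T,T') = 0 < d_R(T,T'), so the inequality d_W(T,T') ≥ d_R(T,T') conjectured by Dehmer, Emmert-Streib and Shi fails. -/
open Finset

/-- The Wiener index: the sum of distances over all unordered pairs of vertices. -/
noncomputable def wiener {V : Type*} [Fintype V] [DecidableEq V] (G : SimpleGraph V) : ℕ :=
  ∑ p : Sym2 V, Sym2.lift ⟨fun u v => G.dist u v, fun _ _ => SimpleGraph.dist_comm⟩ p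

/-- The Randić index: `R(G) = Σ_{uv ∈ E} 1/√(deg u · deg v)`. -/
noncomputable def randic {V : Type*} [Fintype V] [DecidableEq V] (G : SimpleGraph V) : ℝ :=
  letI : DecidableRel G.Adj := Classical.decRel _
  ∑ e ∈ G.edgeFinset,
    Sym2.lift ⟨fun u v => 1 / Real.sqrt ((G.degree u : ℝ) * (G.degree v : ℝ)),
      fun u v => by simp [mul_comm]⟩ e

/-- The graph distance measure on real numbers: `d_σ(a,b) = 1 - exp(-((a-b)/σ)²)`. -/
noncomputable def dMeasure (σ : ℝ) (a b : ℝ) : ℝ :=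
  1 - Real.exp (-((a - b) / σ) ^ 2)

namespace SimpleGraph

variable {V : Type*} {G : SimpleGraph V}

/-- If `f` vanishes at `u` and every other vertex has a neighbour at which `f` is smaller by one,
then each vertex `v` is joined to `u` by a walk of length `f v`. -/
theorem exists_walk_length_eq_of_descent {u : V} {f : V → ℕ}
    (hdesc : ∀ v, v ≠ u → ∃ w, G.Adj w v ∧ f v = f w + 1) (hu : f u = 0) (v : V) :
    ∃ p : G.Walk u v, p.length = f v := by
  induction hn : f v generalizing v with
  | zero =>
    by_cases h : v = u
    · subst h
      exact ⟨.nil, rfl⟩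
    · obtain ⟨w, -, hw⟩ := hdesc v h
      omega
  | succ k ih =>
    have h : v ≠ u := by
      rintro rfl
      omega
    obtain ⟨w, hadj, hw⟩ := hdesc v h
    obtain ⟨p, hp⟩ := ih w (by omega)
    exact ⟨p.concat hadj, by simp [hp]⟩

theorem Walk.le_add_length_of_adj_le {f : V → ℕ} (hstep : ∀ v w, G.Adj v w → f w ≤ f v + 1)
    {u v : V} (p : G.Walk u v) : f v ≤ f u + p.length := by
  induction p with
  | nil => simp
  | cons h p ih =>
    have := hstep _ _ h
    rw [Walk.length_cons]
    omega

/-- A local characterization of the distance function of a connected graph. -/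
structure IsDistFun (G : SimpleGraph V) (d : V → V → ℕ) : Prop where
  self (u : V) : d u u = 0
  step (u v w : V) : G.Adj v w → d u w ≤ d u v + 1
  descent (u v : V) : v ≠ u → ∃ w, G.Adj w v ∧ d u v = d u w + 1

namespace IsDistFun

variable {d : V → V → ℕ}

theorem dist_eq (h : G.IsDistFun d) (u v : V) : G.dist u v = d u v := by
  obtain ⟨p, hp⟩ := exists_walk_length_eq_of_descent (h.descent u) (h.self u) v
  refine le_antisymm (hp ▸ dist_le p) ?_
  obtain ⟨q, hq⟩ := p.reachable.exists_walk_length_eq_dist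
  have := q.le_add_length_of_adj_le (h.step u)
  rw [h.self] at this
  omega

theorem connected [Nonempty V] (h : G.IsDistFun d) : G.Connected where
  preconnected u v :=
    (exists_walk_length_eq_of_descent (h.descent u) (h.self u) v).choose.reachable

theorem symm (h : G.IsDistFun d) (u v : V) : d u v = d v u := by
  rw [← h.dist_eq, ← h.dist_eq, dist_comm]

theorem wiener_eq [Fintype V] [DecidableEq V] (h : G.IsDistFun d) :
    wiener G = ∑ p : Sym2 V, Sym2.lift ⟨d, h.symm⟩ p := by
  refine sum_congr rfl fun p _ => ?_
  induction p with
  | _ u v => exact h.dist_eq u v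

end IsDistFun

end SimpleGraph

theorem randic_eq_sum {V : Type*} [Fintype V] [DecidableEq V] (G : SimpleGraph V)
    [DecidableRel G.Adj] :
    randic G = ∑ e ∈ G.edgeFinset,
      Sym2.lift ⟨fun u v => 1 / Real.sqrt ((G.degree u : ℝ) * (G.degree v : ℝ)),
        fun u v => by simp [mul_comm]⟩ e := by
  unfold randic
  congr!

theorem randic_eq_of_iso {V W : Type*} [Fintype V] [DecidableEq V] [Fintype W] [DecidableEq W]
    {G : SimpleGraph V} {H : SimpleGraph W} (f : G ≃g H) : randic G = randic H := by
  classical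
  rw [randic_eq_sum, randic_eq_sum]
  refine sum_bij (fun e _ => e.map f) ?_ ?_ ?_ ?_
  · intro e he
    induction e with
    | _ u v => simpa [f.map_adj_iff] using he
  · intro e _ e' _ h
    exact Sym2.map.injective f.injective h
  · intro e he
    refine ⟨e.map f.symm, ?_, ?_⟩
    · induction e with
      | _ u v => simpa [f.symm.map_adj_iff] using he
    · induction e with
      | _ u v => simp
  · intro e _
    induction e with
    | _ u v => simp

theorem dMeasure_self (σ a : ℝ) : dMeasure σ a a = 0 := by
  simp [dMeasure]

theorem dMeasure_pos {σ a b : ℝ} (hσ : σ ≠ 0) (hab : a ≠ b) : 0 < dMeasure σ a b := by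
  have : 0 < ((a - b) / σ) ^ 2 := by
    have := sub_ne_zero.mpr hab
    positivity
  simpa [dMeasure] using this

/-- The edges of the spider with three legs of length two. -/
def spiderEdges : Finset (Sym2 (Fin 7)) := {s(0, 1), s(0, 2), s(0, 3), s(1, 4), s(2, 5), s(3, 6)}

/-- The tree with edge set `spiderEdges`. -/
def spider : SimpleGraph (Fin 7) where
  Adj u v := s(u, v) ∈ spiderEdges
  symm := ⟨fun u v h => by rwa [Sym2.eq_swap]⟩
  loopless := ⟨by decide⟩

instance : DecidableRel spider.Adj := fun u v => inferInstanceAs (Decidable (s(u, v) ∈ spiderEdges))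

theorem edgeFinset_spider : spider.edgeFinset = spiderEdges := by
  ext e
  induction e with
  | _ u v =>
    rw [SimpleGraph.mem_edgeFinset, SimpleGraph.mem_edgeSet]
    rfl

/-- The distances in `spider`. -/
def spiderDist : Fin 7 → Fin 7 → ℕ :=
  ![![0, 1, 1, 1, 2, 2, 2],
    ![1, 0, 2, 2, 1, 3, 3],
    ![1, 2, 0, 2, 3, 1, 3],
    ![1, 2, 2, 0, 3, 3, 1],
    ![2, 1, 3, 3, 0, 4, 4],
    ![2, 3, 1, 3, 4, 0, 4],
    ![2, 3, 3, 1, 4, 4, 0]]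

theorem isDistFun_spiderDist : spider.IsDistFun spiderDist :=
  ⟨by decide +kernel, by decide +kernel, by decide +kernel⟩

theorem isTree_spider : spider.IsTree := by
  rw [SimpleGraph.isTree_iff_connected_and_card]
  refine ⟨isDistFun_spiderDist.connected, ?_⟩
  rw [← SimpleGraph.coe_edgeFinset, edgeFinset_spider, Nat.card_eq_fintype_card,
    Nat.card_eq_fintype_card]
  decide +kernel

theorem wiener_spider : wiener spider = 48 := by
  rw [isDistFun_spiderDist.wiener_eq]
  decide +kernel

/-- The edges of the tree obtained from the path `2 - 0 - 1 - 4 - 5` by attaching a leaf to each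
of the vertices `0` and `4`. -/
def forkEdges : Finset (Sym2 (Fin 7)) := {s(0, 1), s(0, 2), s(0, 3), s(1, 4), s(4, 5), s(4, 6)}

/-- The tree with edge set `forkEdges`. -/
def fork : SimpleGraph (Fin 7) where
  Adj u v := s(u, v) ∈ forkEdges
  symm := ⟨fun u v h => by rwa [Sym2.eq_swap]⟩
  loopless := ⟨by decide⟩

instance : DecidableRel fork.Adj := fun u v => inferInstanceAs (Decidable (s(u, v) ∈ forkEdges))

theorem edgeFinset_fork : fork.edgeFinset = forkEdges := by
  ext e
  induction e with
  | _ u v =>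
    rw [SimpleGraph.mem_edgeFinset, SimpleGraph.mem_edgeSet]
    rfl

/-- The distances in `fork`. -/
def forkDist : Fin 7 → Fin 7 → ℕ :=
  ![![0, 1, 1, 1, 2, 3, 3],
    ![1, 0, 2, 2, 1, 2, 2],
    ![1, 2, 0, 2, 3, 4, 4],
    ![1, 2, 2, 0, 3, 4, 4],
    ![2, 1, 3, 3, 0, 1, 1],
    ![3, 2, 4, 4, 1, 0, 2],
    ![3, 2, 4, 4, 1, 2, 0]]

theorem isDistFun_forkDist : fork.IsDistFun forkDist :=
  ⟨by decide +kernel, by decide +kernel, by decide +kernel⟩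

theorem isTree_fork : fork.IsTree := by
  rw [SimpleGraph.isTree_iff_connected_and_card]
  refine ⟨isDistFun_forkDist.connected, ?_⟩
  rw [← SimpleGraph.coe_edgeFinset, edgeFinset_fork, Nat.card_eq_fintype_card,
    Nat.card_eq_fintype_card]
  decide +kernel

theorem wiener_fork : wiener fork = 48 := by
  rw [isDistFun_forkDist.wiener_eq]
  decide +kernel

theorem randic_spider : randic spider = 3 / √2 + 3 / √6 := by
  have hdeg : ∀ v, spider.degree v = (![3, 2, 2, 2, 1, 1, 1] : Fin 7 → ℕ) v := by decide +kernel
  have hsum : ∀ f : Sym2 (Fin 7) → ℝ, ∑ e ∈ spiderEdges, f e =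
      f s(0, 1) + f s(0, 2) + f s(0, 3) + f s(1, 4) + f s(2, 5) + f s(3, 6) := by
    intro f
    rw [spiderEdges]
    repeat rw [sum_insert (by decide)]
    rw [sum_singleton]
    ring
  rw [randic_eq_sum, edgeFinset_spider, hsum]
  simp only [Sym2.lift_mk, hdeg, Matrix.cons_val]
  norm_num
  ring

theorem randic_fork : randic fork = 4 / √3 + 2 / √6 := by
  have hdeg : ∀ v, fork.degree v = (![3, 2, 1, 1, 3, 1, 1] : Fin 7 → ℕ) v := by decide +kernel
  have hsum : ∀ f : Sym2 (Fin 7) → ℝ, ∑ e ∈ forkEdges, f e =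
      f s(0, 1) + f s(0, 2) + f s(0, 3) + f s(1, 4) + f s(4, 5) + f s(4, 6) := by
    intro f
    rw [forkEdges]
    repeat rw [sum_insert (by decide)]
    rw [sum_singleton]
    ring
  rw [randic_eq_sum, edgeFinset_fork, hsum]
  simp only [Sym2.lift_mk, hdeg, Matrix.cons_val]
  norm_num
  ring

theorem randic_spider_ne_randic_fork : randic spider ≠ randic fork := by
  rw [randic_spider, randic_fork]
  have h2 : 0 < √2 := by positivity
  have h3 : 0 < √3 := by positivity
  have h6 : √6 = √2 * √3 := by rw [← Real.sqrt_mul (by norm_num)]; norm_num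
  have s2 : √2 ^ 2 = 2 := Real.sq_sqrt (by norm_num)
  have s3 : √3 ^ 2 = 3 := Real.sq_sqrt (by norm_num)
  rw [h6]
  intro h
  field_simp at h
  have h' : 3 * √3 + 1 = 4 * √2 := by linarith
  have := congrArg (· ^ 2) h'
  nlinarith

/-- There exist two non-isomorphic trees on the same number of vertices with the
same Wiener index but different Randić index; hence `d_W(T,T') = 0 < d_R(T,T')`
for every nonzero `σ`, refuting the conjecture `d_W(T,T') ≥ d_R(T,T')`. -/
theorem conjecture_dW_ge_dR_fails :
    ∃ (n : ℕ) (T T' : SimpleGraph (Fin n)),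
      T.IsTree ∧ T'.IsTree ∧ IsEmpty (T ≃g T') ∧
      wiener T = wiener T' ∧ randic T ≠ randic T' ∧
      ∀ σ : ℝ, σ ≠ 0 →
        dMeasure σ (wiener T) (wiener T') = 0 ∧
        0 < dMeasure σ (randic T) (randic T') ∧
        ¬ dMeasure σ (wiener T) (wiener T') ≥ dMeasure σ (randic T) (randic T') := by
  have hne := randic_spider_ne_randic_fork
  have hW : wiener spider = wiener fork := wiener_spider.trans wiener_fork.symm
  refine ⟨7, spider, fork, isTree_spider, isTree_fork,
    ⟨fun f => hne (randic_eq_of_iso f)⟩, hW, hne, fun σ hσ => ?_⟩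
  rw [hW, dMeasure_self]
  exact ⟨rfl, dMeasure_pos hσ hne, (dMeasure_pos hσ hne).not_ge⟩
end

section
/- There exist two non-cospectral trees T and T' on the same number n of vertices such that E(T) = E(T') and Ig(T) ≠ Ig(T'). Consequently, for every nonzero real σ, d_E(T,T') = 0 < d_{Ig}(T,T'), so the inequality d_E(T,T') ≥ d_{Ig}(T,T') conjectured by Dehmer, Emmert-Streib and Shi fails. -/
open Finset Matrix

/-- The adjacency matrix of a simple graph over `ℝ` is Hermitian. -/
theorem adjMatrix_isHermitian {n : ℕ} (G : SimpleGraph (Fin n)) [DecidableRel G.Adj] :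
    (G.adjMatrix ℝ).IsHermitian := by
  show (G.adjMatrix ℝ)ᴴ = G.adjMatrix ℝ
  rw [Matrix.conjTranspose_eq_transpose_of_trivial]
  exact G.isSymm_adjMatrix

/-- The eigenvalues of the (real) adjacency matrix of a graph on `n` vertices. -/
noncomputable def adjEigenvalues {n : ℕ} (G : SimpleGraph (Fin n)) : Fin n → ℝ :=
  letI : DecidableRel G.Adj := Classical.decRel _
  (adjMatrix_isHermitian G).eigenvalues

/-- The multiset of adjacency eigenvalues (the spectrum) of a graph. -/
noncomputable def adjSpectrum {n : ℕ} (G : SimpleGraph (Fin n)) : Multiset ℝ :=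
  Finset.univ.val.map (adjEigenvalues G)

/-- The graph energy: `E(G) = Σᵢ |λᵢ|`. -/
noncomputable def graphEnergy {n : ℕ} (G : SimpleGraph (Fin n)) : ℝ :=
  ∑ i, |adjEigenvalues G i|

/-- The spectral entropy measure
`Ig(G) = log E(G) - (1/E(G)) · Σᵢ |λᵢ| log |λᵢ|` (with `0 · log 0 = 0`,
as `Real.log 0 = 0`). -/
noncomputable def Ig {n : ℕ} (G : SimpleGraph (Fin n)) : ℝ :=
  Real.log (graphEnergy G) -
    (1 / graphEnergy G) * ∑ i, |adjEigenvalues G i| * Real.log |adjEigenvalues G i|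

namespace EquienergeticTrees

section Spectrum

variable {n : ℕ}

/-- A diagonalization of the adjacency matrix determines the spectrum. -/
theorem adjSpectrum_eq_of_mul_eq (G : SimpleGraph (Fin n)) [DecidableRel G.Adj]
    (P : Matrix (Fin n) (Fin n) ℝ) (d : Fin n → ℝ)
    (h : G.adjMatrix ℝ * P = P * diagonal d) (hP : IsUnit P.det) :
    adjSpectrum G = Finset.univ.val.map d := by
  have hA : G.adjMatrix ℝ = P * (diagonal d * P⁻¹) := by
    rw [← mul_assoc, ← h, mul_assoc, mul_nonsing_inv P hP, mul_one]
  have hchar : (G.adjMatrix ℝ).charpoly = (diagonal d).charpoly := by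
    rw [hA, charpoly_mul_comm, mul_assoc, nonsing_inv_mul P hP, mul_one]
  have hroots := (adjMatrix_isHermitian G).roots_charpoly_eq_eigenvalues
  have hspec : adjSpectrum G = Finset.univ.val.map (adjMatrix_isHermitian G).eigenvalues := by
    unfold adjSpectrum adjEigenvalues
    congr!
  rw [hspec]
  refine hroots.symm.trans ?_
  rw [hchar, charpoly_diagonal, Polynomial.roots_prod]
  · simp
  · simp [Finset.prod_ne_zero_iff, Polynomial.X_sub_C_ne_zero]

theorem graphEnergy_eq_sum_adjSpectrum (G : SimpleGraph (Fin n)) :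
    graphEnergy G = ((adjSpectrum G).map fun x => |x|).sum := by
  simp [graphEnergy, adjSpectrum, Finset.sum, Function.comp_def]

theorem Ig_eq_adjSpectrum (G : SimpleGraph (Fin n)) :
    Ig G = Real.log ((adjSpectrum G).map fun x => |x|).sum -
      (1 / ((adjSpectrum G).map fun x => |x|).sum) *
        ((adjSpectrum G).map fun x => |x| * Real.log |x|).sum := by
  rw [← graphEnergy_eq_sum_adjSpectrum]
  simp [Ig, adjSpectrum, Finset.sum, Function.comp_def]

/-- The embedding of `ℤ[√5]` into the reals. -/
noncomputable def sqrtFiveHom : ℤ√5 →+* ℝ :=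
  Zsqrtd.lift ⟨√5, by simp⟩

theorem sqrtFiveHom_mk (a b : ℤ) : sqrtFiveHom ⟨a, b⟩ = a + b * √5 := rfl

theorem sqrtFiveHom_injective : Function.Injective sqrtFiveHom := by
  refine Zsqrtd.lift_injective _ fun m hm => ?_
  have h₁ : m ≤ 2 := by nlinarith
  have h₂ : -2 ≤ m := by nlinarith
  interval_cases m <;> omega

/-- An orthogonal eigenbasis over `ℤ[√5]`, with the eigenvalues doubled to have integral
coordinates, determines the spectrum. -/
theorem adjSpectrum_eq_of_zsqrtd (G : SimpleGraph (Fin n)) [DecidableRel G.Adj]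
    (P : Matrix (Fin n) (Fin n) (ℤ√5)) (D e : Fin n → ℤ√5) (d : Fin n → ℝ)
    (h : 2 * G.adjMatrix (ℤ√5) * P = P * diagonal D)
    (hP : Pᵀ * P = diagonal e) (he : ∀ i, e i ≠ 0)
    (hd : ∀ i, sqrtFiveHom (D i) = 2 * d i) :
    adjSpectrum G = Finset.univ.val.map d := by
  have hadj : sqrtFiveHom.mapMatrix (G.adjMatrix (ℤ√5)) = G.adjMatrix ℝ := by
    ext i j
    simp [SimpleGraph.adjMatrix_apply, apply_ite sqrtFiveHom]
  have hdiag : sqrtFiveHom.mapMatrix (diagonal D) = 2 * diagonal d := by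
    have : (fun i => sqrtFiveHom (D i)) = (2 : ℝ) • d := funext fun i => by simp [hd]
    rw [RingHom.mapMatrix_apply, diagonal_map (map_zero _)]
    change diagonal (fun i => sqrtFiveHom (D i)) = _
    rw [this, diagonal_smul, two_smul, two_mul]
  refine adjSpectrum_eq_of_mul_eq G (sqrtFiveHom.mapMatrix P) d ?_ ?_
  · have h' := congrArg sqrtFiveHom.mapMatrix h
    rw [map_mul, map_mul, map_mul, hadj, hdiag, map_ofNat, mul_assoc, two_mul, two_mul, mul_add,
      ← two_smul ℝ, ← two_smul ℝ] at h'
    exact smul_right_injective _ (two_ne_zero) h'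
  · have : NoZeroDivisors (ℤ√5) :=
      sqrtFiveHom_injective.noZeroDivisors _ (map_zero _) (map_mul _)
    have hdet : P.det * P.det = ∏ i, e i := by
      rw [← det_diagonal, ← hP, det_mul, det_transpose]
    have hne : P.det ≠ 0 := fun h0 =>
      Finset.prod_ne_zero_iff.mpr (fun i _ => he i) (by rw [← hdet, h0, zero_mul])
    rw [← RingHom.map_det, isUnit_iff_ne_zero]
    exact (map_ne_zero_iff _ sqrtFiveHom_injective).mpr hne

end Spectrum

section Trees

/-- The graph joining every vertex to its parent; a root is its own parent. -/
def parentGraph {n : ℕ} (p : Fin n → Fin n) : SimpleGraph (Fin n) :=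
  SimpleGraph.fromRel fun a b => p a = b

instance {n : ℕ} (p : Fin n → Fin n) : DecidableRel (parentGraph p).Adj :=
  inferInstanceAs (DecidableRel (SimpleGraph.fromRel fun a b => p a = b).Adj)

theorem parentGraph_connected {n : ℕ} (p : Fin (n + 1) → Fin (n + 1))
    (hp : ∀ v, v ≠ 0 → p v < v) : (parentGraph p).Connected := by
  have hroot : ∀ v, (parentGraph p).Reachable v 0 := by
    intro v
    induction v using WellFoundedLT.induction with
    | ind v ih =>
      by_cases hv : v = 0
      · rw [hv]
      · have hadj : (parentGraph p).Adj v (p v) :=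
          (SimpleGraph.fromRel_adj _ _ _).mpr ⟨(hp v hv).ne', Or.inl rfl⟩
        exact hadj.reachable.trans (ih _ (hp v hv))
  exact SimpleGraph.connected_iff_exists_forall_reachable _ |>.mpr ⟨0, fun v => (hroot v).symm⟩

/-- The tree obtained from the star `K₁,₄` by subdividing every edge. -/
abbrev subdividedStar : SimpleGraph (Fin 9) :=
  parentGraph ![0, 0, 0, 0, 0, 1, 2, 3, 4]

/-- The tree with three legs of lengths `1`, `2` and `5` attached to a central vertex. -/
abbrev threeLegs : SimpleGraph (Fin 9) :=
  parentGraph ![0, 0, 0, 2, 0, 4, 5, 6, 7]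

theorem subdividedStar_isTree : subdividedStar.IsTree := by
  rw [SimpleGraph.isTree_iff_connected_and_card]
  refine ⟨parentGraph_connected _ (by decide), ?_⟩
  rw [Nat.card_eq_fintype_card, Nat.card_eq_fintype_card, ← SimpleGraph.edgeFinset_card]
  decide +kernel

theorem threeLegs_isTree : threeLegs.IsTree := by
  rw [SimpleGraph.isTree_iff_connected_and_card]
  refine ⟨parentGraph_connected _ (by decide), ?_⟩
  rw [Nat.card_eq_fintype_card, Nat.card_eq_fintype_card, ← SimpleGraph.edgeFinset_card]
  decide +kernel

open Real in
theorem adjSpectrum_subdividedStar :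
    adjSpectrum subdividedStar =
      Finset.univ.val.map ![0, √5, -√5, 1, -1, 1, -1, 1, -1] := by
  refine adjSpectrum_eq_of_zsqrtd subdividedStar
    !![1, 4, 4, 0, 0, 0, 0, 0, 0;
      0, ⟨0, 1⟩, ⟨0, -1⟩, 1, -1, 1, -1, 1, -1;
      0, ⟨0, 1⟩, ⟨0, -1⟩, -1, 1, 1, -1, 1, -1;
      0, ⟨0, 1⟩, ⟨0, -1⟩, 0, 0, -2, 2, 1, -1;
      0, ⟨0, 1⟩, ⟨0, -1⟩, 0, 0, 0, 0, -3, 3;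
      -1, 1, 1, 1, 1, 1, 1, 1, 1;
      -1, 1, 1, -1, -1, 1, 1, 1, 1;
      -1, 1, 1, 0, 0, -2, -2, 1, 1;
      -1, 1, 1, 0, 0, 0, 0, -3, -3]
    ![⟨0, 0⟩, ⟨0, 2⟩, ⟨0, -2⟩, ⟨2, 0⟩, ⟨-2, 0⟩, ⟨2, 0⟩, ⟨-2, 0⟩, ⟨2, 0⟩, ⟨-2, 0⟩]
    ![5, 40, 40, 4, 4, 12, 12, 24, 24] _
    (by decide +kernel) (by decide +kernel) (by decide +kernel) ?_
  intro i
  fin_cases i <;> simp [sqrtFiveHom_mk]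

open Real in
theorem adjSpectrum_threeLegs :
    adjSpectrum threeLegs =
      Finset.univ.val.map ![0, 1, -1, 2, -2, goldenRatio, -goldenRatio, -goldenConj,
        goldenConj] := by
  let P : Matrix (Fin 9) (Fin 9) (ℤ√5) :=
    !![0, 0, 0, 12, -12, -2, 2, 2, -2;
      -2, 0, 0, 6, 6, ⟨1, -1⟩, ⟨1, -1⟩, ⟨1, 1⟩, ⟨1, 1⟩;
      0, 2, 2, 8, 8, -2, -2, -2, -2;
      0, 2, -2, 4, -4, ⟨1, -1⟩, ⟨-1, 1⟩, ⟨-1, -1⟩, ⟨1, 1⟩;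
      2, -2, -2, 10, 10, 0, 0, 0, 0;
      0, -2, 2, 8, -8, 2, -2, -2, 2;
      -2, 0, 0, 6, 6, ⟨1, 1⟩, ⟨1, 1⟩, ⟨1, -1⟩, ⟨1, -1⟩;
      0, 2, -2, 4, -4, ⟨1, 1⟩, ⟨-1, -1⟩, ⟨-1, 1⟩, ⟨1, -1⟩;
      2, 2, 2, 2, 2, 2, 2, 2, 2]
  refine adjSpectrum_eq_of_zsqrtd threeLegs P
    ![⟨0, 0⟩, ⟨2, 0⟩, ⟨-2, 0⟩, ⟨4, 0⟩, ⟨-4, 0⟩, ⟨1, 1⟩, ⟨-1, -1⟩, ⟨-1, 1⟩, ⟨1, -1⟩]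
    (fun i => (Pᵀ * P) i i) _
    (by decide +kernel) (by decide +kernel) (by decide +kernel) ?_
  intro i
  fin_cases i <;> simp [sqrtFiveHom_mk, goldenRatio, goldenConj] <;> ring

end Trees

section Comparison

open Real

theorem sum_abs_adjSpectrum_subdividedStar :
    ((adjSpectrum subdividedStar).map fun x => |x|).sum = 2 * √5 + 6 := by
  rw [adjSpectrum_subdividedStar, Multiset.map_map]
  change ∑ i, _ = _
  simp [Fin.sum_univ_succ, abs_of_nonneg (sqrt_nonneg 5)]
  ring

theorem sum_abs_adjSpectrum_threeLegs :
    ((adjSpectrum threeLegs).map fun x => |x|).sum = 2 * √5 + 6 := by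
  rw [adjSpectrum_threeLegs, Multiset.map_map]
  change ∑ i, _ = _
  simp [Fin.sum_univ_succ, abs_of_pos goldenRatio_pos, abs_of_neg goldenConj_neg]
  simp only [goldenRatio, goldenConj]
  ring

theorem sum_abs_mul_log_adjSpectrum_subdividedStar :
    ((adjSpectrum subdividedStar).map fun x => |x| * log |x|).sum = √5 * log 5 := by
  rw [adjSpectrum_subdividedStar, Multiset.map_map]
  change ∑ i, _ = _
  simp [Fin.sum_univ_succ, abs_of_nonneg (sqrt_nonneg 5), log_sqrt]
  ring

theorem sum_abs_mul_log_adjSpectrum_threeLegs :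
    ((adjSpectrum threeLegs).map fun x => |x| * log |x|).sum =
      4 * log 2 + 2 * log goldenRatio := by
  have hlog : log goldenConj = -log goldenRatio := by
    rw [← log_neg_eq_log, ← inv_goldenRatio, log_inv]
  rw [adjSpectrum_threeLegs, Multiset.map_map]
  change ∑ i, _ = _
  simp [Fin.sum_univ_succ, abs_of_pos goldenRatio_pos, abs_of_neg goldenConj_neg, hlog]
  linear_combination 2 * log goldenRatio * goldenRatio_add_goldenConj

theorem sqrt_five_mul_log_five_lt : √5 * log 5 < 4 * log 2 + 2 * log goldenRatio := by
  have hsqrt : √5 ≤ 9 / 4 := (sqrt_le_left (by norm_num)).mpr (by norm_num)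
  have hsqrt' : 2.2 ≤ √5 := le_sqrt_of_sq_le (by norm_num)
  have hgold : (8 / 5 : ℝ) ≤ goldenRatio := by
    rw [goldenRatio]
    linarith
  have hlog : log ((5 : ℝ) ^ 9) < log (2 ^ 16 * (8 / 5) ^ 8) :=
    log_lt_log (by norm_num) (by norm_num)
  rw [log_mul (by norm_num) (by norm_num), log_pow, log_pow, log_pow] at hlog
  have hgold' : log (8 / 5) ≤ log goldenRatio := log_le_log (by norm_num) hgold
  have hmul := mul_le_mul_of_nonneg_right hsqrt (log_nonneg (by norm_num : (1 : ℝ) ≤ 5))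
  push_cast at hlog
  linarith

theorem graphEnergy_subdividedStar_eq_threeLegs :
    graphEnergy subdividedStar = graphEnergy threeLegs := by
  rw [graphEnergy_eq_sum_adjSpectrum, graphEnergy_eq_sum_adjSpectrum,
    sum_abs_adjSpectrum_subdividedStar, sum_abs_adjSpectrum_threeLegs]

theorem Ig_threeLegs_lt_subdividedStar : Ig threeLegs < Ig subdividedStar := by
  rw [Ig_eq_adjSpectrum, Ig_eq_adjSpectrum, sum_abs_adjSpectrum_subdividedStar,
    sum_abs_adjSpectrum_threeLegs, sum_abs_mul_log_adjSpectrum_subdividedStar,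
    sum_abs_mul_log_adjSpectrum_threeLegs]
  have hpos : (0 : ℝ) < 1 / (2 * √5 + 6) := by positivity
  linarith [mul_lt_mul_of_pos_left sqrt_five_mul_log_five_lt hpos]

theorem dMeasure_self (σ a : ℝ) : dMeasure σ a a = 0 := by
  simp [dMeasure]

theorem dMeasure_pos {σ a b : ℝ} (hσ : σ ≠ 0) (hab : a ≠ b) : 0 < dMeasure σ a b := by
  have : 0 < ((a - b) / σ) ^ 2 := by
    have := div_ne_zero (sub_ne_zero.mpr hab) hσ
    positivity
  rw [dMeasure, sub_pos, exp_lt_one_iff]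
  linarith

end Comparison

end EquienergeticTrees

/-- There exist two non-cospectral trees on the same number of vertices with the
same graph energy but different spectral entropy `Ig`; hence
`d_E(T,T') = 0 < d_{Ig}(T,T')` for every nonzero `σ`, refuting the conjecture
`d_E(T,T') ≥ d_{Ig}(T,T')`. -/
theorem conjecture_dE_ge_dIg_fails :
    ∃ (n : ℕ) (T T' : SimpleGraph (Fin n)),
      T.IsTree ∧ T'.IsTree ∧ adjSpectrum T ≠ adjSpectrum T' ∧
      graphEnergy T = graphEnergy T' ∧ Ig T ≠ Ig T' ∧
      ∀ σ : ℝ, σ ≠ 0 →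
        dMeasure σ (graphEnergy T) (graphEnergy T') = 0 ∧
        0 < dMeasure σ (Ig T) (Ig T') ∧
        ¬ dMeasure σ (graphEnergy T) (graphEnergy T') ≥ dMeasure σ (Ig T) (Ig T') := by
  have hE := EquienergeticTrees.graphEnergy_subdividedStar_eq_threeLegs
  have hIg := EquienergeticTrees.Ig_threeLegs_lt_subdividedStar.ne'
  refine ⟨9, EquienergeticTrees.subdividedStar, EquienergeticTrees.threeLegs,
    EquienergeticTrees.subdividedStar_isTree, EquienergeticTrees.threeLegs_isTree,
    fun h => hIg ?_, hE, hIg, fun σ hσ => ?_⟩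
  · rw [EquienergeticTrees.Ig_eq_adjSpectrum, EquienergeticTrees.Ig_eq_adjSpectrum, h]
  · have hpos := EquienergeticTrees.dMeasure_pos hσ hIg
    rw [hE, EquienergeticTrees.dMeasure_self]
    exact ⟨rfl, hpos, hpos.not_ge⟩
end

section
/- For every real number k ≥ 1, one has 2·9^k·log(9^k) + 2·4^k·log(4^k) < 3·4^k·log(4^k) + 16^k·log(16^k); in particular the two sides are never equal for k ≥ 1. This generalizes the case k = 1 and shows If_k(T) ≠ If_k(T') for the caterpillar pair with quadruples (9,4,9,4) and (4,16,4,4) for every k ≥ 1. -/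
/-- Since `3 ^ 5 < 2 ^ 8`, the ratio `log 3 / log 2` is less than `8 / 5`. -/
lemma five_mul_log_three_lt_eight_mul_log_two : 5 * Real.log 3 < 8 * Real.log 2 := by
  have h : Real.log ((3 : ℝ) ^ 5) < Real.log ((2 : ℝ) ^ 8) :=
    Real.log_lt_log (by norm_num) (by norm_num)
  simpa only [Real.log_pow, Nat.cast_ofNat] using h

lemma sixteen_mul_nine_rpow_le {k : ℝ} (hk : 1 ≤ k) :
    16 * (9 : ℝ) ^ k ≤ 9 * (16 : ℝ) ^ k := by
  have h : (16 / 9 : ℝ) ≤ (16 / 9 : ℝ) ^ k := Real.self_le_rpow_of_one_le (by norm_num) hk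
  rw [Real.div_rpow (by norm_num) (by norm_num), div_le_div_iff₀ (by norm_num) (by positivity)] at h
  linarith

/-- For every real `k ≥ 1`,
`2·9^k·log(9^k) + 2·4^k·log(4^k) < 3·4^k·log(4^k) + 16^k·log(16^k)`;
in particular the two sides are never equal for `k ≥ 1`.  This shows
`If_k(T) ≠ If_k(T')` for the caterpillar pair with quadruples `(9,4,9,4)` and
`(4,16,4,4)` for every `k ≥ 1` (real powers, natural logarithm). -/
theorem degree_power_entropy_contributions_differ :
    ∀ k : ℝ, 1 ≤ k →
      (2 * (9 : ℝ) ^ k * Real.log ((9 : ℝ) ^ k) + 2 * (4 : ℝ) ^ k * Real.log ((4 : ℝ) ^ k)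
        < 3 * (4 : ℝ) ^ k * Real.log ((4 : ℝ) ^ k) + (16 : ℝ) ^ k * Real.log ((16 : ℝ) ^ k)) ∧
      2 * (9 : ℝ) ^ k * Real.log ((9 : ℝ) ^ k) + 2 * (4 : ℝ) ^ k * Real.log ((4 : ℝ) ^ k)
        ≠ 3 * (4 : ℝ) ^ k * Real.log ((4 : ℝ) ^ k) + (16 : ℝ) ^ k * Real.log ((16 : ℝ) ^ k) := by
  intro k hk
  have hlt : 2 * (9 : ℝ) ^ k * Real.log ((9 : ℝ) ^ k) + 2 * (4 : ℝ) ^ k * Real.log ((4 : ℝ) ^ k)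
      < 3 * (4 : ℝ) ^ k * Real.log ((4 : ℝ) ^ k) + (16 : ℝ) ^ k * Real.log ((16 : ℝ) ^ k) := by
    have h9 : Real.log 9 = 2 * Real.log 3 := by
      rw [show (9 : ℝ) = 3 ^ 2 by norm_num, Real.log_pow, Nat.cast_ofNat]
    have h16 : Real.log 16 = 4 * Real.log 2 := by
      rw [show (16 : ℝ) = 2 ^ 4 by norm_num, Real.log_pow, Nat.cast_ofNat]
    have hmain : 2 * (9 : ℝ) ^ k * Real.log 9 < (16 : ℝ) ^ k * Real.log 16 := by
      rw [h9, h16]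
      have hlog2 : 0 < Real.log 2 := Real.log_pos (by norm_num)
      have hpow : 0 < (9 : ℝ) ^ k := by positivity
      have h₁ := mul_lt_mul_of_pos_left five_mul_log_three_lt_eight_mul_log_two hpow
      have h₂ := mul_le_mul_of_nonneg_right (sixteen_mul_nine_rpow_le hk) hlog2.le
      linarith [mul_pos hpow hlog2]
    have h4 : 0 < (4 : ℝ) ^ k * Real.log 4 := mul_pos (by positivity) (Real.log_pos (by norm_num))
    rw [Real.log_rpow (by norm_num), Real.log_rpow (by norm_num), Real.log_rpow (by norm_num)]
    have hk0 : 0 < k := by linarith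
    linarith [mul_lt_mul_of_pos_left hmain hk0, mul_pos hk0 h4]
  exact ⟨hlt, hlt.ne⟩
end
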